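/- Rooted partial failure trace equivalence is the largest congruence for the operators of CCSP_t that is included in partial failure trace equivalence; equivalently, for all processes P and Q: rfft(P) = rfft(Q) if and only if fft(C[P]) = fft(C[Q]) for every unary recursion-free CCSP_t-context C. -/

import Mathlib

/-! ### The process algebra CCSP_t

The countably infinite set `A` of visible actions and the countably infinite set `V`
of variables are both taken to be `ℕ`. -/

/-- Actions: visible actions from `A = ℕ`, the hidden action `τ`,
and the time-out action `t`. -/
inductive Act : Type
  | act : ℕ → Act
  | tau : Act
  | timeout : Act

/-- CCSP_t expressions.  A recursive specification `S` is represented as a partial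
function `ℕ → Option Expr`; its domain is the set `V_S` of bound variables, and
`⟨X|S⟩` is written `Expr.fix X S`. -/
inductive Expr : Type
  | nil : Expr
  | pre : Act → Expr → Expr
  | choice : Expr → Expr → Expr
  | par : Set ℕ → Expr → Expr → Expr
  | abs : Set ℕ → Expr → Expr
  | ren : Set (ℕ × ℕ) → Expr → Expr
  | var : ℕ → Expr
  | fix : ℕ → (ℕ → Option Expr) → Expr

/-- `α.notIn S`: the action `α` is not a visible action belonging to `S ⊆ A`. -/
def Act.notIn (α : Act) (S : Set ℕ) : Prop := ∀ a : ℕ, α = Act.act a → a ∉ S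

/-- Relational substitution: `Subst ρ E E'` holds iff `E'` is the result of replacing,
in `E`, every free occurrence of each variable `Y` in the domain of `ρ` by the
expression `ρ Y` (occurrences bound by an inner recursion are not replaced). -/
inductive Subst : (ℕ → Option Expr) → Expr → Expr → Prop
  | nil {ρ} : Subst ρ .nil .nil
  | pre {ρ α E E'} : Subst ρ E E' → Subst ρ (.pre α E) (.pre α E')
  | choice {ρ E F E' F'} : Subst ρ E E' → Subst ρ F F' →
      Subst ρ (.choice E F) (.choice E' F')
  | par {ρ S E F E' F'} : Subst ρ E E' → Subst ρ F F' →
      Subst ρ (.par S E F) (.par S E' F')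
  | abs {ρ I E E'} : Subst ρ E E' → Subst ρ (.abs I E) (.abs I E')
  | ren {ρ R E E'} : Subst ρ E E' → Subst ρ (.ren R E) (.ren R E')
  | varNone {ρ Y} : ρ Y = none → Subst ρ (.var Y) (.var Y)
  | varSome {ρ Y F} : ρ Y = some F → Subst ρ (.var Y) F
  | fix {ρ Z} {T T' : ℕ → Option Expr} :
      (∀ Y, T Y = none ↔ T' Y = none) →
      (∀ Y E E', T Y = some E → T' Y = some E' →
          Subst (fun W => if (T W).isSome then none else ρ W) E E') →
      Subst ρ (.fix Z T) (.fix Z T')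

/-- The substitution replacing each bound variable `Y` of `S` by `⟨Y|S⟩`. -/
def recmap (S : ℕ → Option Expr) : ℕ → Option Expr :=
  fun Y => (S Y).map (fun _ => Expr.fix Y S)

/-- The structural operational (interleaving) semantics of CCSP_t. -/
inductive Step : Expr → Act → Expr → Prop
  | pre {α E} : Step (.pre α E) α E
  | choiceL {E F α E'} : Step E α E' → Step (.choice E F) α E'
  | choiceR {E F α F'} : Step F α F' → Step (.choice E F) α F'
  | renTau {R E E'} : Step E .tau E' → Step (.ren R E) .tau (.ren R E')
  | renTimeout {R E E'} : Step E .timeout E' →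
      Step (.ren R E) .timeout (.ren R E')
  | renAct {R E E' a b} : Step E (.act a) E' → (a, b) ∈ R →
      Step (.ren R E) (.act b) (.ren R E')
  | parL {S E F α E'} : Step E α E' → α.notIn S →
      Step (.par S E F) α (.par S E' F)
  | parR {S E F α F'} : Step F α F' → α.notIn S →
      Step (.par S E F) α (.par S E F')
  | parSync {S E F a E' F'} : Step E (.act a) E' → Step F (.act a) F' → a ∈ S →
      Step (.par S E F) (.act a) (.par S E' F')
  | absFree {I E α E'} : Step E α E' → α.notIn I →
      Step (.abs I E) α (.abs I E')
  | absHide {I E a E'} : Step E (.act a) E' → a ∈ I →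
      Step (.abs I E) .tau (.abs I E')
  | fixUnfold {X S E E' α F} : S X = some E → Subst (recmap S) E E' →
      Step E' α F → Step (.fix X S) α F

/-- Free occurrence of a variable in a CCSP_t expression. -/
inductive Free (x : ℕ) : Expr → Prop
  | pre {α E} : Free x E → Free x (.pre α E)
  | choiceL {E F} : Free x E → Free x (.choice E F)
  | choiceR {E F} : Free x F → Free x (.choice E F)
  | parL {S E F} : Free x E → Free x (.par S E F)
  | parR {S E F} : Free x F → Free x (.par S E F)
  | abs {I E} : Free x E → Free x (.abs I E)
  | ren {R E} : Free x E → Free x (.ren R E)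
  | var : Free x (.var x)
  | fix {Z T Y E} : T Y = some E → Free x E → T x = none → Free x (.fix Z T)

/-- An expression is closed if no variable occurs free in it. -/
def Closed (E : Expr) : Prop := ∀ x, ¬ Free x E

/-- Well-formedness: in every recursion `⟨X|S⟩` occurring in the expression the
variable `X` is bound by `S`, and every relational renaming occurring in it has
finite images `{b | (a,b) ∈ R}`. -/
inductive WF : Expr → Prop
  | nil : WF .nil
  | pre {α E} : WF E → WF (.pre α E)
  | choice {E F} : WF E → WF F → WF (.choice E F)
  | par {S E F} : WF E → WF F → WF (.par S E F)
  | abs {I E} : WF E → WF (.abs I E)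
  | ren {R E} : (∀ a : ℕ, {b | (a, b) ∈ R}.Finite) → WF E → WF (.ren R E)
  | var {X} : WF (.var X)
  | fix {X T} : (T X).isSome → (∀ Y E, T Y = some E → WF E) → WF (.fix X T)

/-- `ℙ`: a process is a closed well-formed CCSP_t expression. -/
def IsProcess (E : Expr) : Prop := Closed E ∧ WF E

/-- A process is stable if it has no outgoing τ-transitions. -/
def stable (P : Expr) : Prop := ¬ ∃ P', Step P .tau P'

/-- The set `I(P)` of initial visible actions of a process. -/
def initials (P : Expr) : Set ℕ := {a | ∃ P', Step P (.act a) P'}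

/-! ### Partial failure traces -/

/-- An element of a partial failure trace: a visible action `a ∈ A`
or a refusal set `X ⊆ A`. -/
abbrev Elt : Type := Sum ℕ (Set ℕ)

/-- Partial failure traces: sequences over `A ∪ 𝒫(A)`; the final tag `⊤` is
left implicit. -/
abbrev PFT : Type := List Elt

/-- The set of partial failure traces of a process (Table 3). -/
inductive fft : Expr → PFT → Prop
  | top {P} : fft P []
  | act {P Q a ρ} : Step P (.act a) Q → fft Q ρ → fft P (Sum.inl a :: ρ)
  | tau {P Q ρ} : Step P .tau Q → fft Q ρ → fft P ρ
  | refusal {P X ρ} : (∀ a ∈ X, a ∉ initials P) → stable P → fft P ρ →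
      fft P (Sum.inr X :: ρ)
  | timeoutRef {P Q X ρ} : (∀ a ∈ X, a ∉ initials P) → stable P →
      Step P .timeout Q → fft Q (Sum.inr X :: ρ) → fft P (Sum.inr X :: ρ)
  | timeoutAct {P Q X a ρ} : (∀ a' ∈ X, a' ∉ initials P) → stable P →
      Step P .timeout Q → fft Q (Sum.inl a :: ρ) → a ∈ X →
      fft P (Sum.inr X :: Sum.inl a :: ρ)

def fftSet (P : Expr) : Set PFT := {σ | fft P σ}

/-! ### Rooted partial failure traces -/

/-- Rooted partial failure traces: ordinary partial failure traces, traces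
`t·Xσ` starting with a time-out transition (represented as `rooted X σ`,
standing for the trace `Xσ` preceded by `t`), and the two tags `st`
and `post-st`. -/
inductive RPFT : Type
  | plain : PFT → RPFT
  | rooted : Set ℕ → PFT → RPFT
  | st : RPFT
  | postst : RPFT

/-- The set `rfft(P)` of rooted partial failure traces of a process. -/
def rfftSet (P : Expr) : Set RPFT :=
  {r |
    (∃ σ, r = RPFT.plain σ ∧ fft P σ) ∨
    (r = RPFT.st ∧ stable P) ∨
    (∃ X σ, r = RPFT.rooted X σ ∧ stable P ∧ (∀ a ∈ X, a ∉ initials P) ∧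
      ∃ P', Step P .timeout P' ∧ fft P' (Sum.inr X :: σ)) ∨
    (r = RPFT.postst ∧ (∃ P', Step P .tau P') ∧ fft P [Sum.inr (∅ : Set ℕ)])}

/-! ### Unary recursion-free CCSP_t-contexts -/

/-- Unary recursion-free CCSP_t-contexts: expressions built from a hole and the
operators of CCSP_t, with expressions as further arguments. -/
inductive Ctx : Type
  | hole : Ctx
  | pre : Act → Ctx → Ctx
  | choiceL : Ctx → Expr → Ctx
  | choiceR : Expr → Ctx → Ctx
  | parL : Set ℕ → Ctx → Expr → Ctx
  | parR : Set ℕ → Expr → Ctx → Ctx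
  | abs : Set ℕ → Ctx → Ctx
  | ren : Set (ℕ × ℕ) → Ctx → Ctx

/-- `C.fill P = C[P]`: the process obtained by filling the hole with `P`. -/
def Ctx.fill : Ctx → Expr → Expr
  | .hole, P => P
  | .pre α C, P => .pre α (C.fill P)
  | .choiceL C Q, P => .choice (C.fill P) Q
  | .choiceR Q C, P => .choice Q (C.fill P)
  | .parL S C Q, P => .par S (C.fill P) Q
  | .parR S Q C, P => .par S Q (C.fill P)
  | .abs I C, P => .abs I (C.fill P)
  | .ren R C, P => .ren R (C.fill P)

/-- The further arguments of the context are closed processes, and all renaming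
operators in the context have finite images. -/
inductive Ctx.OK : Ctx → Prop
  | hole : Ctx.OK .hole
  | pre {α C} : Ctx.OK C → Ctx.OK (.pre α C)
  | choiceL {C Q} : Ctx.OK C → IsProcess Q → Ctx.OK (.choiceL C Q)
  | choiceR {Q C} : IsProcess Q → Ctx.OK C → Ctx.OK (.choiceR Q C)
  | parL {S C Q} : Ctx.OK C → IsProcess Q → Ctx.OK (.parL S C Q)
  | parR {S Q C} : IsProcess Q → Ctx.OK C → Ctx.OK (.parR S Q C)
  | abs {I C} : Ctx.OK C → Ctx.OK (.abs I C)
  | ren {R C} : (∀ a : ℕ, {b | (a, b) ∈ R}.Finite) → Ctx.OK C → Ctx.OK (.ren R C)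

/-! ### Basic facts about partial failure traces -/

/-- `P` is stable and has no initial action in `X`. -/
def Refuses (P : Expr) (X : Set ℕ) : Prop := stable P ∧ ∀ a ∈ X, a ∉ initials P

theorem Refuses.fft {P : Expr} {X : Set ℕ} (h : Refuses P X) : fft P [Sum.inr X] :=
  .refusal h.2 h.1 .top

theorem mem_initials_of_fft {P : Expr} {a : ℕ} {ρ : PFT} (hs : stable P)
    (h : fft P (Sum.inl a :: ρ)) : a ∈ initials P := by
  cases h with
  | act h _ => exact ⟨_, h⟩
  | tau h _ => exact absurd ⟨_, h⟩ hs

theorem refuses_of_fft {P : Expr} {X : Set ℕ} {ρ : PFT} (hs : stable P)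
    (h : fft P (Sum.inr X :: ρ)) : Refuses P X := by
  cases h with
  | tau h _ => exact absurd ⟨_, h⟩ hs
  | refusal h _ _ => exact ⟨hs, h⟩
  | timeoutRef h _ _ _ => exact ⟨hs, h⟩
  | timeoutAct h _ _ _ _ => exact ⟨hs, h⟩

/-- `Next X σ' σ`: a process refusing `X` that times out into a process with trace `σ'`
has the trace `Xσ`. -/
def Next (X : Set ℕ) (σ' σ : PFT) : Prop :=
  σ' = Sum.inr X :: σ ∨ σ' = σ ∧ ∃ b ∈ X, ∃ τ, σ = Sum.inl b :: τ

theorem fft_of_next {P P' : Expr} {X : Set ℕ} {σ' σ : PFT} (hr : Refuses P X)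
    (ht : Step P .timeout P') (hn : Next X σ' σ) (h : fft P' σ') :
    fft P (Sum.inr X :: σ) := by
  rcases hn with rfl | ⟨rfl, b, hb, τ, rfl⟩
  · exact .timeoutRef hr.2 hr.1 ht h
  · exact .timeoutAct hr.2 hr.1 ht h hb

/-- Case analysis on a trace that starts with a refusal set. -/
theorem fft_inr_cases {P : Expr} {X : Set ℕ} {σ : PFT} (hs : stable P)
    (h : fft P (Sum.inr X :: σ)) :
    fft P σ ∨ ∃ P' σ', Step P .timeout P' ∧ Next X σ' σ ∧ fft P' σ' := by
  cases h with
  | tau h _ => exact absurd ⟨_, h⟩ hs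
  | refusal _ _ h => exact .inl h
  | timeoutRef _ _ ht h => exact .inr ⟨_, _, ht, .inl rfl, h⟩
  | timeoutAct _ _ ht h ha => exact .inr ⟨_, _, ht, .inr ⟨rfl, _, ha, _, rfl⟩, h⟩

/-- Induction over traces that start with a refusal set `X`. -/
theorem fft_inr_induction {X : Set ℕ} {σ : PFT} {motive : Expr → Prop}
    (tau : ∀ P Q, Step P .tau Q → motive Q → motive P)
    (refusal : ∀ P, Refuses P X → fft P σ → motive P)
    (timeoutRef : ∀ P Q, Refuses P X → Step P .timeout Q → motive Q → motive P)
    (timeoutAct : ∀ P Q a ρ, Refuses P X → Step P .timeout Q → a ∈ X →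
      σ = Sum.inl a :: ρ → fft Q σ → motive P)
    {P : Expr} (h : fft P (Sum.inr X :: σ)) : motive P := by
  generalize hτ : (Sum.inr X :: σ : PFT) = τ at h
  induction h with
  | top => cases hτ
  | act => cases hτ
  | tau h _ ih => exact tau _ _ h (ih hτ)
  | refusal hX hs h => cases hτ; exact refusal _ ⟨hs, hX⟩ h
  | timeoutRef hX hs ht _ ih => cases hτ; exact timeoutRef _ _ ⟨hs, hX⟩ ht (ih rfl)
  | timeoutAct hX hs ht h ha => cases hτ; exact timeoutAct _ _ _ _ ⟨hs, hX⟩ ht ha rfl h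

/-- Induction over traces that start with an action `a`. -/
theorem fft_inl_induction {a : ℕ} {σ : PFT} {motive : Expr → Prop}
    (tau : ∀ P Q, Step P .tau Q → motive Q → motive P)
    (act : ∀ P Q, Step P (.act a) Q → fft Q σ → motive P)
    {P : Expr} (h : fft P (Sum.inl a :: σ)) : motive P := by
  generalize hτ : (Sum.inl a :: σ : PFT) = τ at h
  induction h with
  | tau h _ ih => exact tau _ _ h (ih hτ)
  | act h h' => cases hτ; exact act _ _ h h'
  | _ => cases hτ

/-! ### The rooted partial failure trace preorder -/

/-- The preorder whose kernel is rooted partial failure trace equivalence. -/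
structure RootedLE (P Q : Expr) : Prop where
  fft : ∀ σ, fft P σ → fft Q σ
  stable : stable P ↔ stable Q
  root : ∀ X σ P', Refuses P X → Step P .timeout P' → _root_.fft P' (Sum.inr X :: σ) →
    ∃ Q', Step Q .timeout Q' ∧ _root_.fft Q' (Sum.inr X :: σ)

theorem RootedLE.refuses {P Q : Expr} (h : RootedLE P Q) {X : Set ℕ} (hr : Refuses P X) :
    Refuses Q X :=
  refuses_of_fft (h.stable.1 hr.1) (h.fft _ hr.fft)

theorem RootedLE.refl (P : Expr) : RootedLE P P :=
  ⟨fun _ h => h, Iff.rfl, fun _ _ P' _ ht h => ⟨P', ht, h⟩⟩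

theorem RootedLE.next {P Q P' : Expr} (h : RootedLE P Q) {X : Set ℕ} {σ σ' : PFT}
    (hr : Refuses P X) (ht : Step P .timeout P') (hn : Next X σ' σ) (h' : _root_.fft P' σ') :
    ∃ Q' σ'', Step Q .timeout Q' ∧ Next X σ'' σ ∧ _root_.fft Q' σ'' := by
  have hQ := h.refuses hr
  rcases hn with rfl | ⟨rfl, b, hb, τ, rfl⟩
  · obtain ⟨Q', hQt, hQ'⟩ := h.root _ _ _ hr ht h'
    exact ⟨Q', _, hQt, .inl rfl, hQ'⟩
  · have hf := h.fft _ (fft_of_next hr ht (.inr ⟨rfl, b, hb, τ, rfl⟩) h')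
    rcases fft_inr_cases hQ.1 hf with hf | hf
    · exact absurd (mem_initials_of_fft hQ.1 hf) (hQ.2 b hb)
    · exact hf

theorem rfftSet_subset_iff (P Q : Expr) :
    (rfftSet P ⊆ rfftSet Q ∧ rfftSet Q ⊆ rfftSet P) ↔ RootedLE P Q ∧ RootedLE Q P := by
  have plain : ∀ P σ, RPFT.plain σ ∈ rfftSet P ↔ fft P σ := by
    intro P σ; simp [rfftSet]
  have st : ∀ P, RPFT.st ∈ rfftSet P ↔ stable P := by
    intro P; simp [rfftSet]
  have rooted : ∀ P X σ, RPFT.rooted X σ ∈ rfftSet P ↔ stable P ∧ (∀ a ∈ X, a ∉ initials P) ∧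
      ∃ P', Step P .timeout P' ∧ fft P' (Sum.inr X :: σ) := by
    intro P X σ
    simp only [rfftSet, Set.mem_ofPred_eq, reduceCtorEq, false_and, exists_false, false_or,
      or_false, RPFT.rooted.injEq]
    constructor
    · rintro ⟨_, _, ⟨rfl, rfl⟩, h⟩; exact h
    · intro h; exact ⟨_, _, ⟨rfl, rfl⟩, h⟩
  have postst : ∀ P, RPFT.postst ∈ rfftSet P ↔ ¬ stable P ∧ fft P [Sum.inr (∅ : Set ℕ)] := by
    intro P; simp [rfftSet, stable]
  constructor
  · rintro ⟨h₁, h₂⟩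
    have key : ∀ P Q, rfftSet P ⊆ rfftSet Q → rfftSet Q ⊆ rfftSet P → RootedLE P Q := by
      intro P Q h₁ h₂
      refine ⟨fun σ h => (plain _ _).1 (h₁ ((plain _ _).2 h)),
        ⟨fun h => (st _).1 (h₁ ((st _).2 h)), fun h => (st _).1 (h₂ ((st _).2 h))⟩, ?_⟩
      intro X σ P' hr ht h
      exact ((rooted _ _ _).1 (h₁ ((rooted _ _ _).2 ⟨hr.1, hr.2, P', ht, h⟩))).2.2
    exact ⟨key _ _ h₁ h₂, key _ _ h₂ h₁⟩
  · have key : ∀ P Q, RootedLE P Q → rfftSet P ⊆ rfftSet Q := by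
      intro P Q h r hr
      cases r with
      | plain σ => rw [plain] at hr ⊢; exact h.fft _ hr
      | st => rw [st] at hr ⊢; exact h.stable.1 hr
      | rooted X σ =>
        rw [rooted] at hr ⊢
        obtain ⟨hs, hX, P', ht, hf⟩ := hr
        have hQ := h.refuses ⟨hs, hX⟩
        exact ⟨hQ.1, hQ.2, h.root _ _ _ ⟨hs, hX⟩ ht hf⟩
      | postst =>
        rw [postst] at hr ⊢
        exact ⟨fun hQ => hr.1 (h.stable.2 hQ), h.fft _ hr.2⟩
    exact fun h => ⟨key _ _ h.1, key _ _ h.2⟩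

theorem rfftSet_eq_iff (P Q : Expr) :
    rfftSet P = rfftSet Q ↔ RootedLE P Q ∧ RootedLE Q P := by
  rw [← rfftSet_subset_iff, Set.Subset.antisymm_iff]

/-! ### Static contexts

Parallel composition, abstraction and renaming are instances of a context with internal
state that moves on its own or transforms the visible actions of the process in its hole. -/

/-- A context with internal state whose transitions are its own transitions (`own`), the
transitions obtained from a visible action of the argument (`sync`), and the hidden and
time-out transitions of the argument. -/
structure StaticCtx where
  State : Type
  run : State → Expr → Expr
  own : State → Act → State → Prop
  sync : State → ℕ → Act → State → Prop
  step_own : ∀ {e α e' P}, own e α e' → Step (run e P) α (run e' P)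
  step_sync : ∀ {e a β e' P P'}, sync e a β e' → Step P (.act a) P' →
    Step (run e P) β (run e' P')
  step_tau : ∀ {e P P'}, Step P .tau P' → Step (run e P) .tau (run e P')
  step_timeout : ∀ {e P P'}, Step P .timeout P' → Step (run e P) .timeout (run e P')
  sync_timeout : ∀ {e a e'}, ¬ sync e a .timeout e'
  step_inv : ∀ {e P β R}, Step (run e P) β R →
    (∃ e', own e β e' ∧ R = run e' P) ∨
    (∃ a e' P', Step P (.act a) P' ∧ sync e a β e' ∧ R = run e' P') ∨
    (∃ P', Step P .tau P' ∧ β = .tau ∧ R = run e P') ∨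
    (∃ P', Step P .timeout P' ∧ β = .timeout ∧ R = run e P')

namespace StaticCtx

variable (M : StaticCtx)

/-- In state `e` the context itself contributes no hidden action and no action of `X`. -/
def Quiet (e : M.State) (X : Set ℕ) : Prop :=
  (∀ e', ¬ M.own e .tau e') ∧ ∀ b ∈ X, ∀ d, ¬ M.own e (.act b) d

/-- The actions offered to the argument when the environment offers `X`. -/
def offer (e : M.State) (X : Set ℕ) : Set ℕ :=
  {a | ∃ e', M.sync e a .tau e' ∨ ∃ b ∈ X, M.sync e a (.act b) e'}

theorem refuses_run_iff {e : M.State} {P : Expr} {X : Set ℕ} :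
    Refuses (M.run e P) X ↔ M.Quiet e X ∧ Refuses P (M.offer e X) := by
  constructor
  · rintro ⟨hs, hX⟩
    refine ⟨⟨fun e' h => hs ⟨_, M.step_own h⟩, fun b hb e' h => hX b hb ⟨_, M.step_own h⟩⟩,
      fun ⟨P', h⟩ => hs ⟨_, M.step_tau h⟩, ?_⟩
    rintro a ⟨e', h | ⟨b, hb, h⟩⟩ ⟨P', hP⟩
    · exact hs ⟨_, M.step_sync h hP⟩
    · exact hX b hb ⟨_, M.step_sync h hP⟩
  · rintro ⟨⟨q₁, q₂⟩, hs, hX⟩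
    constructor
    · rintro ⟨R, h⟩
      rcases M.step_inv h with ⟨e', h, -⟩ | ⟨a, e', P', hP, h, -⟩ | ⟨P', h, -⟩ | ⟨_, _, h, _⟩
      · exact q₁ _ h
      · exact hX a ⟨e', .inl h⟩ ⟨_, hP⟩
      · exact hs ⟨_, h⟩
      · cases h
    · rintro b hb ⟨R, h⟩
      rcases M.step_inv h with ⟨e', h, -⟩ | ⟨a, e', P', hP, h, -⟩ | ⟨_, _, h, _⟩ | ⟨_, _, h, _⟩
      · exact q₂ b hb _ h
      · exact hX a ⟨e', .inr ⟨b, hb, h⟩⟩ ⟨_, hP⟩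
      · cases h
      · cases h

/-- `M.Trans e σ ρ`: the context in state `e` transforms the trace `ρ` of its argument into
the trace `σ`. -/
inductive Trans : M.State → PFT → PFT → Prop
  | nil {e} : Trans e [] []
  | ownTau {e e' σ ρ} : M.own e .tau e' → Trans e' σ ρ → Trans e σ ρ
  | ownAct {e b e' σ ρ} : M.own e (.act b) e' → Trans e' σ ρ → Trans e (Sum.inl b :: σ) ρ
  | syncTau {e a e' σ ρ} : M.sync e a .tau e' → Trans e' σ ρ → Trans e σ (Sum.inl a :: ρ)
  | syncAct {e a b e' σ ρ} : M.sync e a (.act b) e' → Trans e' σ ρ →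
      Trans e (Sum.inl b :: σ) (Sum.inl a :: ρ)
  | refusal {e X σ ρ} : M.Quiet e X → Trans e σ ρ →
      (∀ a ∈ M.offer e X, ∀ τ, ρ ≠ Sum.inl a :: τ) →
      Trans e (Sum.inr X :: σ) (Sum.inr (M.offer e X) :: ρ)
  | refusalAct {e X σ σ' a ρ} : M.Quiet e X → a ∈ M.offer e X → Next X σ' σ →
      Trans e σ' (Sum.inl a :: ρ) →
      Trans e (Sum.inr X :: σ) (Sum.inr (M.offer e X) :: Sum.inl a :: ρ)
  | ownTimeout {e e' X σ σ' ρ} : M.Quiet e X → M.own e .timeout e' → Next X σ' σ →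
      Trans e' σ' ρ → (∀ a ∈ M.offer e X, ∀ τ, ρ ≠ Sum.inl a :: τ) →
      Trans e (Sum.inr X :: σ) (Sum.inr (M.offer e X) :: ρ)

variable {M}

theorem Trans.fft_run {e : M.State} {σ ρ : PFT} (h : M.Trans e σ ρ) :
    ∀ P, fft P ρ → fft (M.run e P) σ := by
  induction h with
  | nil => exact fun P _ => .top
  | ownTau h _ ih => exact fun P hP => .tau (M.step_own h) (ih P hP)
  | ownAct h _ ih => exact fun P hP => .act (M.step_own h) (ih P hP)
  | @syncTau _ _ _ σ _ h _ ih =>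
    intro P hP
    exact fft_inl_induction (motive := fun P => fft (M.run _ P) σ)
      (fun _ _ ht hm => .tau (M.step_tau ht) hm)
      (fun _ _ ha hf => .tau (M.step_sync h ha) (ih _ hf)) hP
  | @syncAct _ _ b _ σ _ h _ ih =>
    intro P hP
    exact fft_inl_induction (motive := fun P => fft (M.run _ P) (Sum.inl b :: σ))
      (fun _ _ ht hm => .tau (M.step_tau ht) hm)
      (fun _ _ ha hf => .act (M.step_sync h ha) (ih _ hf)) hP
  | @refusal e X σ _ hq _ hn ih =>
    intro P hP
    refine fft_inr_induction (motive := fun P => fft (M.run e P) (Sum.inr X :: σ))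
      (fun _ _ ht hm => .tau (M.step_tau ht) hm)
      (fun P hr hf => ?_) (fun P P' hr ht hm => ?_) (fun P P' a ρ _ _ ha he _ => ?_) hP
    · have hR := M.refuses_run_iff.2 ⟨hq, hr⟩
      exact .refusal hR.2 hR.1 (ih _ hf)
    · exact fft_of_next (M.refuses_run_iff.2 ⟨hq, hr⟩) (M.step_timeout ht) (.inl rfl) hm
    · exact absurd he (hn a ha ρ)
  | @refusalAct e X σ _ _ _ hq ha hN _ ih =>
    intro P hP
    refine fft_inr_induction (motive := fun P => fft (M.run e P) (Sum.inr X :: σ))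
      (fun _ _ ht hm => .tau (M.step_tau ht) hm)
      (fun P hr hf => ?_) (fun P P' hr ht hm => ?_) (fun P P' a ρ hr ht _ _ hf => ?_) hP
    · exact absurd (mem_initials_of_fft hr.1 hf) (hr.2 _ ha)
    · exact fft_of_next (M.refuses_run_iff.2 ⟨hq, hr⟩) (M.step_timeout ht) (.inl rfl) hm
    · exact fft_of_next (M.refuses_run_iff.2 ⟨hq, hr⟩) (M.step_timeout ht) hN (ih _ hf)
  | @ownTimeout e _ X σ _ _ hq ho hN _ hn ih =>
    intro P hP
    refine fft_inr_induction (motive := fun P => fft (M.run e P) (Sum.inr X :: σ))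
      (fun _ _ ht hm => .tau (M.step_tau ht) hm)
      (fun P hr hf => ?_) (fun P P' hr ht hm => ?_) (fun P P' a ρ _ _ ha he _ => ?_) hP
    · exact fft_of_next (M.refuses_run_iff.2 ⟨hq, hr⟩) (M.step_own ho) hN (ih _ hf)
    · exact fft_of_next (M.refuses_run_iff.2 ⟨hq, hr⟩) (M.step_timeout ht) (.inl rfl) hm
    · exact absurd he (hn a ha ρ)

/-- The trace `ρ` starts with the refusal set `Y` or with an action from `Y`. -/
def Starts (Y : Set ℕ) (ρ : PFT) : Prop :=
  ∃ τ, ρ = Sum.inr Y :: τ ∨ ∃ a ∈ Y, ρ = Sum.inl a :: τ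

variable (M) in
/-- Some trace of `P` is transformed into `σ` in state `e`; moreover, if the context is quiet
on `X` and `σ` starts with `X`, then this trace can be chosen to start with the actions
offered to `P`. -/
def Decomposes (e : M.State) (P : Expr) (σ : PFT) : Prop :=
  (∃ ρ, M.Trans e σ ρ ∧ fft P ρ) ∧
    ∀ X, M.Quiet e X → Starts X σ →
      ∃ ρ, M.Trans e σ ρ ∧ fft P ρ ∧ Starts (M.offer e X) ρ

theorem starts_of_next {X : Set ℕ} {σ' σ : PFT} (h : Next X σ' σ) : Starts X σ' := by
  rcases h with rfl | ⟨rfl, b, hb, τ, rfl⟩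
  · exact ⟨_, .inl rfl⟩
  · exact ⟨_, .inr ⟨b, hb, rfl⟩⟩

theorem decomposes_of_offer {e : M.State} {P : Expr} {X : Set ℕ} {σ ρ : PFT}
    (hT : M.Trans e (Sum.inr X :: σ) (Sum.inr (M.offer e X) :: ρ))
    (hf : fft P (Sum.inr (M.offer e X) :: ρ)) : M.Decomposes e P (Sum.inr X :: σ) := by
  refine ⟨⟨_, hT, hf⟩, ?_⟩
  rintro X' - ⟨τ, h | ⟨a, -, h⟩⟩
  · cases h; exact ⟨_, hT, hf, _, .inl rfl⟩
  · cases h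

theorem not_head_of_refuses {P : Expr} {Y : Set ℕ} {ρ : PFT} (hr : Refuses P Y)
    (hf : fft P ρ) : ∀ a ∈ Y, ∀ τ, ρ ≠ Sum.inl a :: τ := by
  rintro a ha τ rfl
  exact hr.2 a ha (mem_initials_of_fft hr.1 hf)

theorem decomposes_of_timeout {e : M.State} {P R : Expr} {X : Set ℕ} {σ σ' : PFT}
    (hr : Refuses (M.run e P) X) (ht : Step (M.run e P) .timeout R) (hN : Next X σ' σ)
    (ih : ∀ e' P', R = M.run e' P' → M.Decomposes e' P' σ') :
    M.Decomposes e P (Sum.inr X :: σ) := by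
  obtain ⟨hq, hrP⟩ := M.refuses_run_iff.1 hr
  rcases M.step_inv ht with ⟨e', h, rfl⟩ | ⟨a, e', P', -, h, -⟩ | ⟨_, _, h, _⟩ | ⟨P', h, -, rfl⟩
  · obtain ⟨⟨ρ, hT, hf⟩, -⟩ := ih _ _ rfl
    exact decomposes_of_offer (.ownTimeout hq h hN hT (not_head_of_refuses hrP hf))
      (.refusal hrP.2 hrP.1 hf)
  · exact absurd h M.sync_timeout
  · cases h
  · obtain ⟨ρ, hT, hf, τ, rfl | ⟨a, ha, rfl⟩⟩ := (ih _ _ rfl).2 X hq (starts_of_next hN)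
    · rcases hN with rfl | ⟨rfl, b, hb, τ', rfl⟩
      · exact decomposes_of_offer hT (.timeoutRef hrP.2 hrP.1 h hf)
      · generalize hY : M.offer e X = Y at hT
        cases hT with
        | ownTau h _ => exact absurd h (hq.1 _)
        | ownAct h _ => exact absurd h (hq.2 b hb _)
    · exact decomposes_of_offer (.refusalAct hq ha hN hT)
        (.timeoutAct hrP.2 hrP.1 h hf ha)

theorem decomposes_of_fft {R : Expr} {σ : PFT} (h : fft R σ) :
    ∀ e P, R = M.run e P → M.Decomposes e P σ := by
  induction h with
  | top =>
    rintro e P -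
    refine ⟨⟨_, .nil, .top⟩, ?_⟩
    rintro X - ⟨τ, h | ⟨a, -, h⟩⟩ <;> cases h
  | @act R R' b σ hst _ ih =>
    rintro e P rfl
    rcases M.step_inv hst with ⟨e', h, rfl⟩ | ⟨a, e', P', hP, h, rfl⟩ | ⟨_, _, h, _⟩ | ⟨_, _, h, _⟩
    · obtain ⟨⟨ρ, hT, hf⟩, -⟩ := ih _ _ rfl
      refine ⟨⟨_, .ownAct h hT, hf⟩, ?_⟩
      rintro X hq ⟨τ, he | ⟨a, ha, he⟩⟩
      · cases he
      · cases he; exact absurd h (hq.2 _ ha _)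
    · obtain ⟨⟨ρ, hT, hf⟩, -⟩ := ih _ _ rfl
      refine ⟨⟨_, .syncAct h hT, .act hP hf⟩, ?_⟩
      rintro X hq ⟨τ, he | ⟨c, hc, he⟩⟩
      · cases he
      · cases he
        exact ⟨_, .syncAct h hT, .act hP hf, _, .inr ⟨a, ⟨e', .inr ⟨_, hc, h⟩⟩, rfl⟩⟩
    · cases h
    · cases h
  | tau hst _ ih =>
    rintro e P rfl
    rcases M.step_inv hst with ⟨e', h, rfl⟩ | ⟨a, e', P', hP, h, rfl⟩ | ⟨P', h, -, rfl⟩ |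
      ⟨_, _, h, _⟩
    · obtain ⟨⟨ρ, hT, hf⟩, -⟩ := ih _ _ rfl
      exact ⟨⟨_, .ownTau h hT, hf⟩, fun X hq _ => absurd h (hq.1 _)⟩
    · obtain ⟨⟨ρ, hT, hf⟩, -⟩ := ih _ _ rfl
      exact ⟨⟨_, .syncTau h hT, .act hP hf⟩, fun X _ _ =>
        ⟨_, .syncTau h hT, .act hP hf, _, .inr ⟨a, ⟨e', .inl h⟩, rfl⟩⟩⟩
    · obtain ⟨⟨ρ, hT, hf⟩, ih'⟩ := ih _ _ rfl
      refine ⟨⟨_, hT, .tau h hf⟩, fun X hq hs => ?_⟩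
      obtain ⟨ρ, hT, hf, hs'⟩ := ih' X hq hs
      exact ⟨ρ, hT, .tau h hf, hs'⟩
    · cases h
  | refusal hX hs _ ih =>
    rintro e P rfl
    obtain ⟨hq, hr⟩ := M.refuses_run_iff.1 ⟨hs, hX⟩
    obtain ⟨⟨ρ, hT, hf⟩, -⟩ := ih _ _ rfl
    exact decomposes_of_offer (.refusal hq hT (not_head_of_refuses hr hf))
      (.refusal hr.2 hr.1 hf)
  | timeoutRef hX hs ht _ ih =>
    rintro e P rfl
    exact decomposes_of_timeout ⟨hs, hX⟩ ht (.inl rfl) ih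
  | timeoutAct hX hs ht _ ha ih =>
    rintro e P rfl
    exact decomposes_of_timeout ⟨hs, hX⟩ ht (.inr ⟨rfl, _, ha, _, rfl⟩) ih

theorem fft_run_mono {P Q : Expr} (h : ∀ ρ, fft P ρ → fft Q ρ) (e : M.State) {σ : PFT}
    (hσ : fft (M.run e P) σ) : fft (M.run e Q) σ := by
  obtain ⟨⟨ρ, hT, hf⟩, -⟩ := decomposes_of_fft hσ e P rfl
  exact hT.fft_run Q (h ρ hf)

theorem rootedLE_run {P Q : Expr} (h : RootedLE P Q) (h' : RootedLE Q P) (e : M.State) :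
    RootedLE (M.run e P) (M.run e Q) := by
  have st : ∀ {P Q}, RootedLE P Q → stable (M.run e P) → stable (M.run e Q) := by
    intro P Q h hs
    have hr := M.refuses_run_iff.1 (show Refuses (M.run e P) ∅ from ⟨hs, by simp⟩)
    exact (M.refuses_run_iff.2 ⟨hr.1, h.refuses hr.2⟩).1
  refine ⟨fun σ => fft_run_mono h.fft e, ⟨st h, st h'⟩, ?_⟩
  intro X σ R hr ht hf
  obtain ⟨hq, hrP⟩ := M.refuses_run_iff.1 hr
  rcases M.step_inv ht with ⟨e', ho, rfl⟩ | ⟨a, e', P', -, ho, -⟩ | ⟨_, _, ho, _⟩ | ⟨P', hP, -, rfl⟩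
  · exact ⟨_, M.step_own ho, fft_run_mono h.fft e' hf⟩
  · exact absurd ho M.sync_timeout
  · cases ho
  · obtain ⟨ρ, hT, hfP, τ, rfl | ⟨a, ha, rfl⟩⟩ :=
      (decomposes_of_fft hf e P' rfl).2 X hq ⟨_, .inl rfl⟩
    · obtain ⟨Q', hQ, hfQ⟩ := h.root _ _ _ hrP hP hfP
      exact ⟨_, M.step_timeout hQ, hT.fft_run _ hfQ⟩
    · obtain ⟨Q', σ', hQ, hN, hfQ⟩ := h.next hrP hP (.inr ⟨rfl, a, ha, τ, rfl⟩) hfP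
      refine ⟨_, M.step_timeout hQ, ?_⟩
      rcases hN with rfl | ⟨rfl, -⟩
      · exact (Trans.refusalAct hq ha (.inl rfl) hT).fft_run _ hfQ
      · exact hT.fft_run _ hfQ

end StaticCtx

theorem notIn_act {a : ℕ} {S : Set ℕ} : (Act.act a).notIn S ↔ a ∉ S :=
  ⟨fun h => h a rfl, fun h b hb => by cases hb; exact h⟩

theorem notIn_tau {S : Set ℕ} : Act.tau.notIn S := fun _ h => by cases h

theorem notIn_timeout {S : Set ℕ} : Act.timeout.notIn S := fun _ h => by cases h

/-- The transitions of a parallel component induced by the action `a` of the other one. -/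
def parSyncRel (S : Set ℕ) (E : Expr) (a : ℕ) (β : Act) (F : Expr) : Prop :=
  β = .act a ∧ (a ∉ S ∧ F = E ∨ a ∈ S ∧ Step E (.act a) F)

/-- The context `_ ∥_S E` with state `E`. -/
def parLeftCtx (S : Set ℕ) : StaticCtx where
  State := Expr
  run E P := .par S P E
  own E α E' := Step E α E' ∧ α.notIn S
  sync := parSyncRel S
  step_own h := .parR h.1 h.2
  step_sync h hP := by
    rcases h with ⟨rfl, ⟨ha, rfl⟩ | ⟨ha, h⟩⟩
    · exact .parL hP (notIn_act.2 ha)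
    · exact .parSync hP h ha
  step_tau h := .parL h notIn_tau
  step_timeout h := .parL h notIn_timeout
  sync_timeout h := by cases h.1
  step_inv {E P β R} h := by
    cases h with
    | @parL _ _ _ _ P' h hn =>
      cases β with
      | act a => exact .inr (.inl ⟨a, E, P', h, ⟨rfl, .inl ⟨notIn_act.1 hn, rfl⟩⟩, rfl⟩)
      | tau => exact .inr (.inr (.inl ⟨_, h, rfl, rfl⟩))
      | timeout => exact .inr (.inr (.inr ⟨_, h, rfl, rfl⟩))
    | parR h hn => exact .inl ⟨_, ⟨h, hn⟩, rfl⟩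
    | parSync h h' ha => exact .inr (.inl ⟨_, _, _, h, ⟨rfl, .inr ⟨ha, h'⟩⟩, rfl⟩)

/-- The context `E ∥_S _` with state `E`. -/
def parRightCtx (S : Set ℕ) : StaticCtx where
  State := Expr
  run E P := .par S E P
  own E α E' := Step E α E' ∧ α.notIn S
  sync := parSyncRel S
  step_own h := .parL h.1 h.2
  step_sync h hP := by
    rcases h with ⟨rfl, ⟨ha, rfl⟩ | ⟨ha, h⟩⟩
    · exact .parR hP (notIn_act.2 ha)
    · exact .parSync h hP ha
  step_tau h := .parR h notIn_tau
  step_timeout h := .parR h notIn_timeout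
  sync_timeout h := by cases h.1
  step_inv {E P β R} h := by
    cases h with
    | @parR _ _ _ _ P' h hn =>
      cases β with
      | act a => exact .inr (.inl ⟨a, E, P', h, ⟨rfl, .inl ⟨notIn_act.1 hn, rfl⟩⟩, rfl⟩)
      | tau => exact .inr (.inr (.inl ⟨_, h, rfl, rfl⟩))
      | timeout => exact .inr (.inr (.inr ⟨_, h, rfl, rfl⟩))
    | parL h hn => exact .inl ⟨_, ⟨h, hn⟩, rfl⟩
    | parSync h' h ha => exact .inr (.inl ⟨_, _, _, h, ⟨rfl, .inr ⟨ha, h'⟩⟩, rfl⟩)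

/-- The context `τ_I(_)`. -/
def absCtx (I : Set ℕ) : StaticCtx where
  State := Unit
  run _ P := .abs I P
  own _ _ _ := False
  sync _ a β _ := a ∉ I ∧ β = .act a ∨ a ∈ I ∧ β = .tau
  step_own h := h.elim
  step_sync h hP := by
    rcases h with ⟨ha, rfl⟩ | ⟨ha, rfl⟩
    · exact .absFree hP (notIn_act.2 ha)
    · exact .absHide hP ha
  step_tau h := .absFree h notIn_tau
  step_timeout h := .absFree h notIn_timeout
  sync_timeout h := by rcases h with ⟨_, h⟩ | ⟨_, h⟩ <;> cases h
  step_inv {_ P β R} h := by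
    cases h with
    | absFree h hn =>
      cases β with
      | act a => exact .inr (.inl ⟨a, (), _, h, .inl ⟨notIn_act.1 hn, rfl⟩, rfl⟩)
      | tau => exact .inr (.inr (.inl ⟨_, h, rfl, rfl⟩))
      | timeout => exact .inr (.inr (.inr ⟨_, h, rfl, rfl⟩))
    | absHide h ha => exact .inr (.inl ⟨_, (), _, h, .inr ⟨ha, rfl⟩, rfl⟩)

/-- The context `R(_)`. -/
def renCtx (R : Set (ℕ × ℕ)) : StaticCtx where
  State := Unit
  run _ P := .ren R P
  own _ _ _ := False
  sync _ a β _ := ∃ b, (a, b) ∈ R ∧ β = .act b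
  step_own h := h.elim
  step_sync h hP := by
    obtain ⟨b, hb, rfl⟩ := h
    exact .renAct hP hb
  step_tau h := .renTau h
  step_timeout h := .renTimeout h
  sync_timeout h := by obtain ⟨_, _, h⟩ := h; cases h
  step_inv {_ P β R} h := by
    cases h with
    | renTau h => exact .inr (.inr (.inl ⟨_, h, rfl, rfl⟩))
    | renTimeout h => exact .inr (.inr (.inr ⟨_, h, rfl, rfl⟩))
    | renAct h hb => exact .inr (.inl ⟨_, (), _, h, ⟨_, hb, rfl⟩, rfl⟩)

/-! ### Prefixing and choice -/

theorem stable_pre_iff {α : Act} {P : Expr} : stable (.pre α P) ↔ α ≠ .tau := by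
  constructor
  · rintro h rfl; exact h ⟨_, .pre⟩
  · rintro h ⟨_, hs⟩; cases hs; exact h rfl

theorem Refuses.pre {α : Act} {P : Expr} (Q : Expr) {X : Set ℕ} (h : Refuses (.pre α P) X) :
    Refuses (.pre α Q) X := by
  refine ⟨stable_pre_iff.2 (stable_pre_iff.1 h.1), fun a ha => ?_⟩
  rintro ⟨_, hs⟩
  cases hs
  exact h.2 a ha ⟨_, .pre⟩

theorem RootedLE.pre {P Q : Expr} (h : RootedLE P Q) (α : Act) :
    RootedLE (.pre α P) (.pre α Q) := by
  refine ⟨fun σ hσ => ?_, by rw [stable_pre_iff, stable_pre_iff], ?_⟩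
  · generalize hR : Expr.pre α P = R at hσ
    induction hσ with subst hR
    | top => exact .top
    | act hs hf => cases hs; exact .act .pre (h.fft _ hf)
    | tau hs hf => cases hs; exact .tau .pre (h.fft _ hf)
    | refusal hX hs _ ih =>
      have hr := Refuses.pre Q ⟨hs, hX⟩
      exact .refusal hr.2 hr.1 (ih rfl)
    | timeoutRef hX hs ht hf =>
      have hr := Refuses.pre Q ⟨hs, hX⟩
      cases ht
      exact .timeoutRef hr.2 hr.1 .pre (h.fft _ hf)
    | timeoutAct hX hs ht hf ha =>
      have hr := Refuses.pre Q ⟨hs, hX⟩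
      cases ht
      exact .timeoutAct hr.2 hr.1 .pre (h.fft _ hf) ha
  · intro X σ P' _ ht hf
    cases ht
    exact ⟨Q, .pre, h.fft _ hf⟩

theorem step_choice_iff {P E R : Expr} {α : Act} :
    Step (.choice P E) α R ↔ Step P α R ∨ Step E α R := by
  constructor
  · intro h
    cases h with
    | choiceL h => exact .inl h
    | choiceR h => exact .inr h
  · rintro (h | h)
    · exact .choiceL h
    · exact .choiceR h

theorem stable_choice_iff {P E : Expr} : stable (.choice P E) ↔ stable P ∧ stable E := by
  simp only [stable, step_choice_iff, exists_or, not_or]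

theorem refuses_choice_iff {P E : Expr} {X : Set ℕ} :
    Refuses (.choice P E) X ↔ Refuses P X ∧ Refuses E X := by
  simp only [Refuses, stable_choice_iff, initials, step_choice_iff, Set.mem_ofPred_eq, exists_or,
    not_or]
  constructor
  · rintro ⟨⟨h₁, h₂⟩, h⟩
    exact ⟨⟨h₁, fun a ha => (h a ha).1⟩, h₂, fun a ha => (h a ha).2⟩
  · rintro ⟨⟨h₁, h₃⟩, h₂, h₄⟩
    exact ⟨⟨h₁, h₂⟩, fun a ha => ⟨h₃ a ha, h₄ a ha⟩⟩

/-- A trace of a summand is a trace of the choice if it starts with an action or the summand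
is not stable. -/
theorem fft_of_initial {P R : Expr} {σ : PFT} (hR : ∀ α P', Step P α P' → Step R α P')
    (h : fft P σ) (h' : ¬ stable P ∨ ∃ a τ, σ = Sum.inl a :: τ) : fft R σ := by
  cases h with
  | top => exact .top
  | act hs hf => exact .act (hR _ _ hs) hf
  | tau hs hf => exact .tau (hR _ _ hs) hf
  | refusal _ hs _ => simp [hs] at h'
  | timeoutRef _ hs _ _ => simp [hs] at h'
  | timeoutAct _ hs _ _ _ => simp [hs] at h'

theorem RootedLE.choice {P Q E F : Expr} (h : RootedLE P Q) (h' : RootedLE E F) :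
    RootedLE (.choice P E) (.choice Q F) := by
  have hL : ∀ α P', Step Q α P' → Step (.choice Q F) α P' := fun _ _ => .choiceL
  have hR : ∀ α P', Step F α P' → Step (.choice Q F) α P' := fun _ _ => .choiceR
  have ref : ∀ {X}, Refuses (.choice P E) X → Refuses (.choice Q F) X := fun hr =>
    have hr := refuses_choice_iff.1 hr
    refuses_choice_iff.2 ⟨h.refuses hr.1, h'.refuses hr.2⟩
  have next : ∀ {X σ σ' R}, Refuses (.choice P E) X → Step (.choice P E) .timeout R →
      Next X σ' σ → _root_.fft R σ' → _root_.fft (.choice Q F) (Sum.inr X :: σ) := by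
    intro X σ σ' R hr ht hN hf
    have hr' := refuses_choice_iff.1 hr
    rcases step_choice_iff.1 ht with ht | ht
    · obtain ⟨Q', σ'', hQ, hN', hf'⟩ := h.next hr'.1 ht hN hf
      exact fft_of_next (ref hr) (.choiceL hQ) hN' hf'
    · obtain ⟨Q', σ'', hQ, hN', hf'⟩ := h'.next hr'.2 ht hN hf
      exact fft_of_next (ref hr) (.choiceR hQ) hN' hf'
  refine ⟨fun σ hσ => ?_, by rw [stable_choice_iff, stable_choice_iff, h.stable, h'.stable], ?_⟩
  · generalize hR : Expr.choice P E = R at hσ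
    induction hσ with subst hR
    | top => exact .top
    | act hs hf =>
      rcases step_choice_iff.1 hs with hs | hs
      · exact fft_of_initial hL (h.fft _ (.act hs hf)) (.inr ⟨_, _, rfl⟩)
      · exact fft_of_initial hR (h'.fft _ (.act hs hf)) (.inr ⟨_, _, rfl⟩)
    | tau hs hf =>
      rcases step_choice_iff.1 hs with hs | hs
      · exact fft_of_initial hL (h.fft _ (.tau hs hf))
          (.inl fun hQ => h.stable.2 hQ ⟨_, hs⟩)
      · exact fft_of_initial hR (h'.fft _ (.tau hs hf))
          (.inl fun hQ => h'.stable.2 hQ ⟨_, hs⟩)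
    | refusal hX hs _ ih =>
      have hr := ref ⟨hs, hX⟩
      exact .refusal hr.2 hr.1 (ih rfl)
    | timeoutRef hX hs ht hf => exact next ⟨hs, hX⟩ ht (.inl rfl) hf
    | timeoutAct hX hs ht hf ha =>
      exact next ⟨hs, hX⟩ ht (.inr ⟨rfl, _, ha, _, rfl⟩) hf
  · intro X σ R hr ht hf
    have hr' := refuses_choice_iff.1 hr
    rcases step_choice_iff.1 ht with ht | ht
    · obtain ⟨Q', hQ, hf'⟩ := h.root _ _ _ hr'.1 ht hf
      exact ⟨Q', .choiceL hQ, hf'⟩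
    · obtain ⟨Q', hQ, hfQ⟩ := h'.root _ _ _ hr'.2 ht hf
      exact ⟨Q', .choiceR hQ, hfQ⟩

/-- Rooted partial failure trace equivalence is a congruence. -/
theorem rootedLE_fill {P Q : Expr} (h : RootedLE P Q) (h' : RootedLE Q P) (C : Ctx) :
    RootedLE (C.fill P) (C.fill Q) ∧ RootedLE (C.fill Q) (C.fill P) := by
  have static : ∀ (M : StaticCtx) (e : M.State) {P Q : Expr},
      RootedLE P Q ∧ RootedLE Q P →
        RootedLE (M.run e P) (M.run e Q) ∧ RootedLE (M.run e Q) (M.run e P) :=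
    fun M e _ _ h => ⟨StaticCtx.rootedLE_run h.1 h.2 e, StaticCtx.rootedLE_run h.2 h.1 e⟩
  induction C with
  | hole => exact ⟨h, h'⟩
  | pre α C ih => exact ⟨ih.1.pre α, ih.2.pre α⟩
  | choiceL C E ih => exact ⟨ih.1.choice (.refl E), ih.2.choice (.refl E)⟩
  | choiceR E C ih => exact ⟨(RootedLE.refl E).choice ih.1, (RootedLE.refl E).choice ih.2⟩
  | parL S C E ih => exact static (parLeftCtx S) E ih
  | parR S E C ih => exact static (parRightCtx S) E ih
  | abs I C ih => exact static (absCtx I) () ih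
  | ren R C ih => exact static (renCtx R) () ih

/-! ### Distinguishing contexts -/

/-- The renaming `a ↦ a + 1`, which makes the action `0` fresh. -/
def shift : Set (ℕ × ℕ) := {p | p.2 = p.1 + 1}

/-- The inverse of `shift` on elements of partial failure traces. -/
def unshift : Elt → Elt
  | .inl a => .inl (a - 1)
  | .inr X => .inr {a | a + 1 ∈ X}

theorem refuses_ren_shift_iff {P : Expr} {X : Set ℕ} :
    Refuses (.ren shift P) X ↔ Refuses P {a | a + 1 ∈ X} := by
  constructor
  · rintro ⟨hs, hX⟩
    refine ⟨fun ⟨_, h⟩ => hs ⟨_, .renTau h⟩, ?_⟩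
    rintro a ha ⟨_, h⟩
    exact hX _ ha ⟨_, .renAct h rfl⟩
  · rintro ⟨hs, hX⟩
    constructor
    · rintro ⟨_, h⟩
      cases h with
      | renTau h => exact hs ⟨_, h⟩
    · rintro b hb ⟨_, h⟩
      cases h with
      | @renAct _ _ _ a _ h hR =>
        obtain rfl : b = a + 1 := hR
        exact hX a hb ⟨_, h⟩

theorem fft_of_fft_ren_shift {P : Expr} {σ : PFT} (h : fft (.ren shift P) σ) :
    Sum.inl 0 ∉ σ ∧ fft P (σ.map unshift) := by
  generalize hR : Expr.ren shift P = R at h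
  induction h generalizing P with subst hR
  | top => exact ⟨by simp, .top⟩
  | @act _ _ b _ hs _ ih =>
    cases hs with
    | @renAct _ _ _ a _ h hR =>
      obtain rfl : b = a + 1 := hR
      obtain ⟨h0, hf⟩ := ih rfl
      exact ⟨by simpa using h0, .act h hf⟩
  | tau hs _ ih =>
    cases hs with
    | renTau h => exact ⟨(ih rfl).1, .tau h (ih rfl).2⟩
  | refusal hX hs _ ih =>
    have hr := refuses_ren_shift_iff.1 ⟨hs, hX⟩
    exact ⟨by simpa using (ih rfl).1, .refusal hr.2 hr.1 (ih rfl).2⟩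
  | timeoutRef hX hs ht _ ih =>
    have hr := refuses_ren_shift_iff.1 ⟨hs, hX⟩
    cases ht with
    | renTimeout h => exact ⟨(ih rfl).1, .timeoutRef hr.2 hr.1 h (ih rfl).2⟩
  | @timeoutAct _ _ X a _ hX hs ht _ ha ih =>
    have hr := refuses_ren_shift_iff.1 ⟨hs, hX⟩
    cases ht with
    | renTimeout h =>
      obtain ⟨h0, hf⟩ := ih rfl
      refine ⟨by simpa using h0, .timeoutAct hr.2 hr.1 h hf ?_⟩
      cases a with
      | zero => simp at h0
      | succ a => exact ha

theorem fft_ren_shift_of_fft {P : Expr} {σ : PFT} (h0 : Sum.inl 0 ∉ σ)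
    (h : fft P (σ.map unshift)) : fft (.ren shift P) σ := by
  generalize hρ : σ.map unshift = ρ at h
  have inl_inv : ∀ {x : Elt} {a : ℕ}, x ≠ Sum.inl 0 → unshift x = Sum.inl a →
      x = Sum.inl (a + 1) := by
    rintro ((_ | b) | X) a hx h
    · exact absurd rfl hx
    · cases h; rfl
    · cases h
  have inr_inv : ∀ {x : Elt} {Y : Set ℕ}, unshift x = Sum.inr Y →
      ∃ X, x = Sum.inr X ∧ Y = {a | a + 1 ∈ X} := by
    rintro (b | X) Y h
    · cases h
    · cases h; exact ⟨X, rfl, rfl⟩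
  induction h generalizing σ with
  | top =>
    rw [List.map_eq_nil_iff] at hρ
    subst hρ
    exact .top
  | act hs _ ih =>
    obtain ⟨x, σ, rfl, hx, rfl⟩ := List.map_eq_cons_iff.1 hρ
    simp only [List.mem_cons, not_or] at h0
    obtain rfl := inl_inv (Ne.symm h0.1) hx
    exact .act (.renAct hs rfl) (ih h0.2 rfl)
  | tau hs _ ih => exact .tau (.renTau hs) (ih h0 hρ)
  | refusal hX hs _ ih =>
    obtain ⟨x, σ, rfl, hx, rfl⟩ := List.map_eq_cons_iff.1 hρ
    obtain ⟨X, rfl, rfl⟩ := inr_inv hx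
    have hr := refuses_ren_shift_iff.2 ⟨hs, hX⟩
    simp only [List.mem_cons, not_or] at h0
    exact .refusal hr.2 hr.1 (ih h0.2 rfl)
  | timeoutRef hX hs ht _ ih =>
    obtain ⟨x, σ, rfl, hx, rfl⟩ := List.map_eq_cons_iff.1 hρ
    obtain ⟨X, rfl, rfl⟩ := inr_inv hx
    have hr := refuses_ren_shift_iff.2 ⟨hs, hX⟩
    exact .timeoutRef hr.2 hr.1 (.renTimeout ht) (ih h0 rfl)
  | timeoutAct hX hs ht _ ha ih =>
    obtain ⟨x, σ, rfl, hx, hρ'⟩ := List.map_eq_cons_iff.1 hρ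
    obtain ⟨y, σ, rfl, hy, rfl⟩ := List.map_eq_cons_iff.1 hρ'
    obtain ⟨X, rfl, rfl⟩ := inr_inv hx
    have hr := refuses_ren_shift_iff.2 ⟨hs, hX⟩
    simp only [List.mem_cons, not_or] at h0
    obtain rfl := inl_inv (Ne.symm h0.2.1) hy
    exact .timeoutAct hr.2 hr.1 (.renTimeout ht)
      (ih (by simpa only [List.mem_cons, not_or] using h0.2) (by simp [hy])) ha

/-- Shifting of traces, a right inverse of `unshift`. -/
def shiftElt : Elt → Elt
  | .inl a => .inl (a + 1)
  | .inr X => .inr (Nat.succ '' X)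

theorem unshift_shiftElt (x : Elt) : unshift (shiftElt x) = x := by
  rcases x with a | X
  · rfl
  · simp [unshift, shiftElt]

theorem map_unshift_map_shiftElt (σ : PFT) : (σ.map shiftElt).map unshift = σ := by
  simp [List.map_map, Function.comp_def, unshift_shiftElt]

theorem inl_zero_notMem_map_shiftElt (σ : PFT) : Sum.inl 0 ∉ σ.map shiftElt := by
  simp [shiftElt]

theorem shift_finite (a : ℕ) : {b | (a, b) ∈ shift}.Finite :=
  (Set.finite_singleton (a + 1)).subset fun _ h => h

theorem isProcess_nil : IsProcess .nil := ⟨(fun _ h => by cases h), .nil⟩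

theorem IsProcess.pre {P : Expr} (h : IsProcess P) (α : Act) : IsProcess (.pre α P) :=
  ⟨fun x hx => by cases hx; exact h.1 x ‹_›, .pre h.2⟩

theorem Ctx.ok_shift_choice {E : Expr} (hE : IsProcess E) :
    Ctx.OK (.choiceL (.ren shift .hole) E) :=
  .choiceL (.ren shift_finite .hole) hE

theorem stable_ren_shift_iff {P : Expr} : stable (.ren shift P) ↔ stable P := by
  have h := @refuses_ren_shift_iff P ∅
  simpa [Refuses] using h

/-- The context `R(_) + t.b.0`, with `b` fresh, detects stability. -/
theorem fft_shift_choice_timeout_iff {P : Expr} :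
    fft (.choice (.ren shift P) (.pre .timeout (.pre (.act 0) .nil)))
      [Sum.inr {0}, Sum.inl 0] ↔ stable P := by
  constructor
  · intro h
    by_contra hs
    have hs' : ¬ stable (.choice (.ren shift P) (.pre .timeout (.pre (.act 0) .nil))) := by
      rw [stable_choice_iff, stable_ren_shift_iff]
      exact fun h => hs h.1
    cases h with
    | tau ht hf =>
      rcases step_choice_iff.1 ht with ht | ht
      · have h0 := (fft_of_fft_ren_shift (.tau ht hf)).1
        simp at h0
      · cases ht
    | refusal _ h _ => exact hs' h
    | timeoutRef _ h _ _ => exact hs' h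
    | timeoutAct _ h _ _ _ => exact hs' h
  · intro hs
    have hr : Refuses (.choice (.ren shift P) (.pre .timeout (.pre (.act 0) .nil))) {0} := by
      rw [refuses_choice_iff, refuses_ren_shift_iff]
      refine ⟨⟨hs, by simp⟩, ⟨(fun ⟨_, h⟩ => by cases h), ?_⟩⟩
      rintro a - ⟨_, h⟩
      cases h
    exact .timeoutAct hr.2 hr.1 (.choiceR .pre) (.act .pre .top) rfl

/-- The context `R(_) + b.0`, with `b` fresh, detects initial time-outs. -/
theorem fft_shift_choice_act_iff {P : Expr} {X : Set ℕ} {σ : PFT} (hr : Refuses P X) :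
    fft (.choice (.ren shift P) (.pre (.act 0) .nil))
      (Sum.inr (Nat.succ '' X) :: Sum.inr (insert 0 (Nat.succ '' X)) :: σ.map shiftElt) ↔
    ∃ P', Step P .timeout P' ∧ fft P' (Sum.inr X :: σ) := by
  have hmap : (Sum.inr (Nat.succ '' X) :: Sum.inr (insert 0 (Nat.succ '' X)) ::
      σ.map shiftElt : PFT).map unshift = Sum.inr X :: Sum.inr X :: σ := by
    rw [List.map_cons, List.map_cons, map_unshift_map_shiftElt]
    simp [unshift]
  have hX : {a | a + 1 ∈ Nat.succ '' X} = X := by simp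
  have hR : Refuses (.choice (.ren shift P) (.pre (.act 0) .nil)) (Nat.succ '' X) := by
    rw [refuses_choice_iff, refuses_ren_shift_iff, hX]
    refine ⟨hr, ⟨(fun ⟨_, h⟩ => by cases h), ?_⟩⟩
    rintro _ ⟨a, _, rfl⟩ ⟨_, h⟩
    cases h
  constructor
  · intro h
    rcases fft_inr_cases hR.1 h with h | ⟨R, σ', ht, hN, h⟩
    · exact absurd ⟨_, .choiceR .pre⟩ ((refuses_of_fft hR.1 h).2 0 (Set.mem_insert _ _))
    · rcases hN with rfl | ⟨-, b, _, τ, hb⟩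
      · rcases step_choice_iff.1 ht with ht | ht
        · cases ht with
          | renTimeout ht' =>
            refine ⟨_, ht', ?_⟩
            have hf := (fft_of_fft_ren_shift h).2
            rw [hmap] at hf
            exact fft_inr_induction (motive := fun P => fft P (Sum.inr X :: σ))
              (fun _ _ ht hm => .tau ht hm) (fun _ _ hf => hf)
              (fun _ _ hr ht hm => .timeoutRef hr.2 hr.1 ht hm)
              (fun _ _ _ _ _ _ _ he _ => by cases he) hf
        · cases ht
      · cases hb
  · rintro ⟨P', ht, hf⟩
    refine .timeoutRef hR.2 hR.1 (.choiceL (.renTimeout ht)) (fft_ren_shift_of_fft ?_ ?_)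
    · simpa using inl_zero_notMem_map_shiftElt σ
    · rw [hmap]
      exact fft_inr_induction (motive := fun P => fft P (Sum.inr X :: Sum.inr X :: σ))
        (fun _ _ ht hm => .tau ht hm)
        (fun _ hr hf => .refusal hr.2 hr.1 (.refusal hr.2 hr.1 hf))
        (fun _ _ hr ht hm => .timeoutRef hr.2 hr.1 ht hm)
        (fun _ _ _ _ hr ht ha he hf => .refusal hr.2 hr.1 (by
          subst he
          exact .timeoutAct hr.2 hr.1 ht hf ha)) hf

theorem rootedLE_of_fft_fill {P Q : Expr}
    (h : ∀ C : Ctx, Ctx.OK C → fftSet (C.fill P) = fftSet (C.fill Q)) : RootedLE P Q := by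
  have h' : ∀ (C : Ctx) σ, Ctx.OK C → (fft (C.fill P) σ ↔ fft (C.fill Q) σ) :=
    fun C σ hC => Set.ext_iff.1 (h C hC) σ
  have hst : stable P ↔ stable Q := by
    rw [← fft_shift_choice_timeout_iff, ← fft_shift_choice_timeout_iff]
    exact h' (.choiceL (.ren shift .hole) _) _
      (Ctx.ok_shift_choice ((isProcess_nil.pre _).pre _))
  refine ⟨fun σ => (h' .hole σ .hole).1, hst, fun X σ P' hr ht hf => ?_⟩
  have hQ : Refuses Q X := refuses_of_fft (hst.1 hr.1) ((h' .hole _ .hole).1 hr.fft)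
  rw [← fft_shift_choice_act_iff hQ]
  exact (h' (.choiceL (.ren shift .hole) _) _ (Ctx.ok_shift_choice (isProcess_nil.pre _))).1
    ((fft_shift_choice_act_iff hr).2 ⟨P', ht, hf⟩)

/-- Rooted partial failure trace equivalence is the largest
congruence for the operators of CCSP_t included in partial failure trace
equivalence: `rfft(P) = rfft(Q)` iff `fft(C[P]) = fft(C[Q])` for every unary
recursion-free CCSP_t-context `C`. -/
theorem rfft_full_abstraction (P Q : Expr) (hP : IsProcess P) (hQ : IsProcess Q) :
    rfftSet P = rfftSet Q ↔
      ∀ C : Ctx, Ctx.OK C → fftSet (C.fill P) = fftSet (C.fill Q) := by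
  rw [rfftSet_eq_iff]
  constructor
  · rintro ⟨h, h'⟩ C -
    obtain ⟨hC, hC'⟩ := rootedLE_fill h h' C
    exact Set.Subset.antisymm hC.fft hC'.fft
  · exact fun h => ⟨rootedLE_of_fft_fill h, rootedLE_of_fft_fill fun C hC => (h C hC).symm⟩
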